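/- Let N be a finite set, a > 0, and m_i ≥ 0 for each i ∈ N, and define the inventory cost game c(S) = 2a·√(Σ_{i∈S} m_i²) for S ⊆ N. Then c is concave (submodular): for every i ∈ N and all coalitions S ⊆ T ⊆ N \ {i}, c(S ∪ {i}) − c(S) ≥ c(T ∪ {i}) − c(T). -/

import Mathlib

/-- Increments of the square root are antitone in the base point. -/
theorem Real.sqrt_add_sub_sqrt_le {d x y : ℝ} (hd : 0 ≤ d) (hx : 0 ≤ x) (hxy : x ≤ y) :
    √(d + y) - √y ≤ √(d + x) - √x := by
  have hp : √x ≤ √y := Real.sqrt_le_sqrt hxy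
  have huv : √(d + x) ≤ √(d + y) := Real.sqrt_le_sqrt (by linarith)
  have hpu : √x ≤ √(d + x) := Real.sqrt_le_sqrt (by linarith)
  have hx2 := Real.sq_sqrt hx
  have hy2 := Real.sq_sqrt (hx.trans hxy)
  have hdx2 := Real.sq_sqrt (add_nonneg hd hx)
  have hdy2 := Real.sq_sqrt (add_nonneg hd (hx.trans hxy))
  by_contra! h
  have hpos : 0 < √(d + y) + √y := by linarith [Real.sqrt_nonneg y]
  nlinarith [mul_pos (sub_pos.2 h) hpos,
    mul_nonneg (sub_nonneg.2 hpu) (sub_nonneg.2 (add_le_add huv hp))]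

/-- The inventory cost game `c(S) = 2a·√(∑_{i∈S} mᵢ²)` (with `a > 0` and `mᵢ ≥ 0`)
is concave (submodular): for every player `i ∈ N` and coalitions
`S ⊆ T ⊆ N \ {i}`, `c(S ∪ {i}) − c(S) ≥ c(T ∪ {i}) − c(T)`. -/
theorem inventory_game_concave {ι : Type*} [DecidableEq ι] (N : Finset ι)
    (a : ℝ) (ha : 0 < a) (m : ι → ℝ) (hm : ∀ i ∈ N, 0 ≤ m i)
    (c : Finset ι → ℝ)
    (hc : ∀ S : Finset ι, c S = 2 * a * Real.sqrt (∑ i ∈ S, (m i) ^ 2)) :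
    ∀ i ∈ N, ∀ S T : Finset ι, S ⊆ T → T ⊆ N \ {i} →
      c (insert i S) - c S ≥ c (insert i T) - c T := by
  intro i _ S T hST hT
  have hiT : i ∉ T := fun h => by simpa using hT h
  have hiS : i ∉ S := fun h => hiT (hST h)
  have key := Real.sqrt_add_sub_sqrt_le (sq_nonneg (m i))
    (Finset.sum_nonneg fun j (_ : j ∈ S) => sq_nonneg (m j))
    (Finset.sum_le_sum_of_subset_of_nonneg hST fun j _ _ => sq_nonneg (m j))
  simp only [hc, Finset.sum_insert hiT, Finset.sum_insert hiS, ge_iff_le, ← mul_sub]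
  gcongr
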